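/- arXiv:1505.08110 — 6 statements merged into one kernel-verified Lean document; each statement's English description precedes it below -/
import Mathlib

section
/- Let G be a finite group and let A and B be subgroups of G whose orders |A| and |B| are coprime. If every commutator [a,b] = a⁻¹·a^b with a ∈ A, b ∈ B lies in B and centralizes A (i.e., the commutator subgroup [A,B] is contained in C_B(A) = B ∩ C_G(A)), then [A,B] = 1; that is, every element of A commutes with every element of B. -/
open scoped commutatorElement

/-- If the commutator `⁅a, b⁆` commutes with `a`, its order divides the order of `a`. -/
theorem orderOf_commutatorElement_dvd_of_commute {G : Type*} [Group G] {a b : G}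
    (h : Commute ⁅a, b⁆ a) : orderOf ⁅a, b⁆ ∣ orderOf a := by
  have hconj : a⁻¹ * ⁅a, b⁆ = b * a⁻¹ * b⁻¹ := by
    rw [commutatorElement_def]; group
  have hpow := congrArg (· ^ orderOf a) hconj
  simp only [h.symm.inv_left.mul_pow, conj_pow, inv_pow, pow_orderOf_eq_one, inv_one,
    one_mul, mul_one, mul_inv_cancel] at hpow
  exact orderOf_dvd_of_pow_eq_one hpow

/-- Lemma 2.5: if `|A|` and `|B|` are coprime and every commutator `[a,b]` lies in
`B ∩ C_G(A)`, then `[A,B] = 1`, i.e. every element of `A` commutes with every element of `B`. -/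
theorem commutator_eq_bot_of_coprime {G : Type*} [Group G] [Finite G] (A B : Subgroup G)
    (hcop : Nat.Coprime (Nat.card A) (Nat.card B))
    (h : ⁅A, B⁆ ≤ B ⊓ Subgroup.centralizer (A : Set G)) :
    ⁅A, B⁆ = ⊥ ∧ ∀ a ∈ A, ∀ b ∈ B, Commute a b := by
  have hone : ∀ a ∈ A, ∀ b ∈ B, ⁅a, b⁆ = 1 := by
    intro a ha b hb
    obtain ⟨hcB, hcA⟩ := Subgroup.mem_inf.mp (h (Subgroup.commutator_mem_commutator ha hb))
    have hcomm : Commute ⁅a, b⁆ a := (Subgroup.mem_centralizer_iff.mp hcA a ha).symm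
    rw [← orderOf_eq_one_iff]
    exact Nat.eq_one_of_dvd_coprimes hcop
      ((orderOf_commutatorElement_dvd_of_commute hcomm).trans (A.orderOf_dvd_natCard ha))
      (B.orderOf_dvd_natCard hcB)
  refine ⟨?_, fun a ha b hb => commutatorElement_eq_one_iff_commute.mp (hone a ha b hb)⟩
  rw [eq_bot_iff, Subgroup.commutator_le]
  exact fun a ha b hb => Subgroup.mem_bot.mpr (hone a ha b hb)
end

section
/- (Thompson's A×P Lemma.) Let p be a prime and H a finite group such that H = PA, where P is a normal p-subgroup of H and A is a subgroup of H whose order is coprime to p. Suppose there exists a subgroup B ≤ C_P(A) such that [C_P(B), A] = 1. Then [P, A] = 1; consequently P ∩ A = 1 and H is the internal direct product of A and P. -/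
open Subgroup
open scoped commutatorElement

/-- If `⁅x, a⁆` commutes with `a` and the orders of `⁅x, a⁆` and `a` are coprime, then `x` and `a`
commute. -/
theorem commute_of_commute_commutatorElement_of_coprime {G : Type*} [Group G] {x a : G}
    (hcomm : Commute ⁅x, a⁆ a) (hcop : (orderOf ⁅x, a⁆).Coprime (orderOf a)) : Commute x a := by
  have hconj : ⁅x, a⁆ * a = x * a * x⁻¹ := by rw [commutatorElement_def]; group
  have hpow : ⁅x, a⁆ ^ orderOf a = 1 := by
    have h := congrArg (· ^ orderOf a) hconj
    simpa [hcomm.mul_pow, conj_pow, pow_orderOf_eq_one] using h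
  rw [← commutatorElement_eq_one_iff_commute, ← orderOf_eq_one_iff]
  exact Nat.Coprime.eq_one_of_dvd hcop (orderOf_dvd_of_pow_eq_one hpow)

/-- The normalizer condition for a nilpotent subgroup `P` of an ambient group. -/
theorem Subgroup.eq_of_inf_normalizer_le {G : Type*} [Group G] {P C : Subgroup G}
    [Group.IsNilpotent P] (hCP : C ≤ P) (hN : P ⊓ normalizer (C : Set G) ≤ C) : C = P := by
  refine le_antisymm hCP (subgroupOf_eq_top.mp ?_)
  refine normalizerCondition_iff_only_full_group_self_normalizing.mp
    Group.normalizerCondition_of_isNilpotent _ (le_antisymm (fun x hx ↦ ?_) le_normalizer)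
  refine mem_subgroupOf.mpr (hN ⟨x.2, mem_normalizer_iff.mpr fun c ↦ ?_⟩)
  have hmem : ∀ y : P, (y : G) ∈ C ↔ (x * y * x⁻¹ : G) ∈ C := fun y ↦ by
    simpa [mem_subgroupOf] using mem_normalizer_iff.mp hx y
  refine ⟨fun hc ↦ (hmem ⟨c, hCP hc⟩).mp hc, fun hc ↦ ?_⟩
  have hcP : c ∈ P := by
    simpa [mul_assoc] using P.mul_mem (P.mul_mem (P.inv_mem x.2) (hCP hc)) x.2
  exact (hmem ⟨c, hcP⟩).mpr hc

/-- Thompson's `A × P` Lemma (Lemma 2.6): if `H = PA` with `P` a normal `p`-subgroup,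
`A` of order coprime to `p`, and there is `B ≤ C_P(A)` with `[C_P(B), A] = 1`,
then `[P, A] = 1`; consequently `P ∩ A = 1` and `H` is the internal direct
product of `A` and `P`. -/
theorem thompson_A_times_P {p : ℕ} (hp : p.Prime) {H : Type*} [Group H] [Finite H]
    (P A : Subgroup H) (hPn : P.Normal) (hPp : IsPGroup p P)
    (hA : Nat.Coprime (Nat.card A) p)
    (hPA : P ⊔ A = ⊤)
    (B : Subgroup H) (hB : B ≤ P ⊓ Subgroup.centralizer (A : Set H))
    (hC : ⁅P ⊓ Subgroup.centralizer (B : Set H), A⁆ = ⊥) :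
    ⁅P, A⁆ = ⊥ ∧ P ⊓ A = ⊥ := by
  have := Fact.mk hp
  obtain ⟨n, hn⟩ := IsPGroup.iff_card.mp hPp
  have hcop : (Nat.card P).Coprime (Nat.card A) := by
    rw [hn]; exact (hA.pow_right n).symm
  refine ⟨?_, (disjoint_of_coprime_natCard hcop).eq_bot⟩
  have := hPp.isNilpotent
  rw [commutator_eq_bot_iff_le_centralizer] at hC ⊢
  set C := P ⊓ centralizer (A : Set H)
  set N := P ⊓ normalizer (C : Set H)
  have hCA : ⁅C, A⁆ = ⊥ := commutator_eq_bot_iff_le_centralizer.mpr inf_le_right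
  have hself : P ⊓ centralizer (C : Set H) ≤ centralizer (A : Set H) :=
    (inf_le_inf_left P (centralizer_le hB)).trans hC
  have hNCA : ⁅⁅N, C⁆, A⁆ = ⊥ := le_bot_iff.mp <| hCA ▸ commutator_mono
    (le_normalizer_iff_commutator_le_right.mp inf_le_right) le_rfl
  have hANC : ⁅N, A⁆ ≤ centralizer (C : Set H) := by
    rw [commutator_comm, ← commutator_eq_bot_iff_le_centralizer]
    exact commutator_commutator_eq_bot_of_rotate hNCA (by rw [hCA, commutator_bot_left])
  have hNC : N ≤ C := fun x hx ↦ by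
    refine ⟨hx.1, mem_centralizer_iff.mpr fun a ha ↦ ?_⟩
    have hxa : ⁅x, a⁆ ∈ P := commutator_le_left P A (commutator_mem_commutator hx.1 ha)
    have hcent := hself ⟨hxa, hANC (commutator_mem_commutator hx ha)⟩
    exact (commute_of_commute_commutatorElement_of_coprime
      (mem_centralizer_iff.mp hcent a ha).symm
      (hcop.of_dvd (P.orderOf_dvd_natCard hxa) (A.orderOf_dvd_natCard ha))).symm
  exact inf_eq_left.mp (eq_of_inf_normalizer_le inf_le_left hNC)
end

section
/- Let p be a prime and let G be a finite group of characteristic p. Then every normal subgroup K of G is of characteristic p. -/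
/-- The `p`-core `O_p(G)`: the largest normal `p`-subgroup of `G`. -/
def pCore (p : ℕ) (G : Type*) [Group G] : Subgroup G :=
  sSup {H : Subgroup G | H.Normal ∧ IsPGroup p H}

/-- A group `G` is of characteristic `p` if `C_G(O_p(G)) ≤ O_p(G)`. -/
def IsCharacteristicP (p : ℕ) (G : Type*) [Group G] : Prop :=
  Subgroup.centralizer ((pCore p G : Subgroup G) : Set G) ≤ pCore p G

open scoped commutatorElement

theorem le_pCore {p : ℕ} {G : Type*} [Group G] {H : Subgroup G} (hn : H.Normal)
    (hH : IsPGroup p H) : H ≤ pCore p G :=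
  le_sSup ⟨hn, hH⟩

theorem mem_pCore_iff {p : ℕ} {G : Type*} [Group G] {x : G} :
    x ∈ pCore p G ↔ ∃ H : Subgroup G, (H.Normal ∧ IsPGroup p H) ∧ x ∈ H := by
  refine Subgroup.mem_sSup_of_directedOn (K := {H | H.Normal ∧ IsPGroup p H})
    ⟨⊥, inferInstance, IsPGroup.of_bot⟩ ?_
  rintro H ⟨hHn, hH⟩ L ⟨hLn, hL⟩
  exact ⟨H ⊔ L, ⟨Subgroup.sup_normal H L, hH.to_sup_of_normal_right hL⟩, le_sup_left,
    le_sup_right⟩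

theorem isPGroup_pCore (p : ℕ) (G : Type*) [Group G] : IsPGroup p (pCore p G) := by
  rintro ⟨x, hx⟩
  obtain ⟨H, ⟨_, hH⟩, hxH⟩ := mem_pCore_iff.mp hx
  obtain ⟨k, hk⟩ := hH ⟨x, hxH⟩
  exact ⟨k, Subtype.ext (Subtype.ext_iff.mp hk :)⟩

theorem normal_pCore (p : ℕ) (G : Type*) [Group G] : (pCore p G).Normal := by
  refine ⟨fun x hx g => ?_⟩
  obtain ⟨H, ⟨hn, hH⟩, hxH⟩ := mem_pCore_iff.mp hx
  exact le_pCore hn hH (hn.conj_mem x hxH g)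

/-- If `x` commutes with the commutator `⁅x, q⁆`, then `⁅x ^ n, q⁆ = ⁅x, q⁆ ^ n`. -/
theorem commutatorElement_pow_left_of_commute {G : Type*} [Group G] {x q : G}
    (h : Commute x ⁅x, q⁆) (n : ℕ) : ⁅x ^ n, q⁆ = ⁅x, q⁆ ^ n := by
  induction n with
  | zero => simp
  | succ n ih =>
    calc ⁅x ^ (n + 1), q⁆ = x * ⁅x ^ n, q⁆ * x⁻¹ * ⁅x, q⁆ := by
          simp only [commutatorElement_def, pow_succ']; group
      _ = ⁅x, q⁆ ^ (n + 1) := by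
          rw [ih, (h.pow_right n).eq, mul_inv_cancel_right, pow_succ]

/-- Lemma 2.7(a): every normal subgroup of a finite group of characteristic `p`
is of characteristic `p`. -/
theorem isCharacteristicP_of_normal {p : ℕ} (hp : p.Prime) {G : Type*} [Group G] [Finite G]
    (hG : IsCharacteristicP p G) (K : Subgroup G) (hK : K.Normal) :
    IsCharacteristicP p K := by
  have hQn := normal_pCore p G
  have hQ := isPGroup_pCore p G
  have hPn := normal_pCore p K
  have hle : (pCore p G).subgroupOf K ≤ pCore p K :=
    le_pCore inferInstance hQ.comap_subtype
  obtain ⟨k, hk⟩ := isPGroup_iff_exists_pow_pow_eq_one.mp hQ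
  refine le_pCore inferInstance ?_
  rintro ⟨x, hx⟩
  have hxQ : (x : G) ^ p ^ k ∈ pCore p G := by
    refine hG (Subgroup.mem_centralizer_iff_commutator_eq_one'.mpr fun q hq => ?_)
    have huQ : ⁅(x : G), q⁆ ∈ pCore p G :=
      Subgroup.commutator_le_right ⊤ _ (Subgroup.commutator_mem_commutator trivial hq)
    have huK : ⁅(x : G), q⁆ ∈ K :=
      Subgroup.commutator_le_left K ⊤ (Subgroup.commutator_mem_commutator x.2 trivial)
    have hcomm : Commute (x : G) ⁅(x : G), q⁆ :=
      congrArg Subtype.val (Subgroup.mem_centralizer_iff.mp hx ⟨_, huK⟩ (hle huQ)).symm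
    rw [commutatorElement_pow_left_of_commute hcomm]
    exact congrArg Subtype.val (hk ⟨_, huQ⟩)
  obtain ⟨m, hm⟩ := hQ ⟨_, hxQ⟩
  refine ⟨k + m, Subtype.ext (Subtype.ext ?_)⟩
  simpa [pow_add, pow_mul] using congrArg Subtype.val hm
end

section
/- Let p be a prime, G a finite group, S a Sylow p-subgroup of G, and P ≤ S. Then P is fully centralized in F_S(G) (that is, |C_S(P)| ≥ |C_S(P^g)| for every g ∈ G with P^g ≤ S) if and only if C_S(P) is a Sylow p-subgroup of C_G(P). -/
/-- The conjugate `P^g = g⁻¹ P g` of a subgroup. -/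
def conjSubgroup {G : Type*} [Group G] (P : Subgroup G) (g : G) : Subgroup G :=
  Subgroup.map ((MulAut.conj g⁻¹).toMonoidHom) P

theorem mem_conjSubgroup {G : Type*} [Group G] {P : Subgroup G} {g x : G} :
    x ∈ conjSubgroup P g ↔ g * x * g⁻¹ ∈ P := by
  constructor
  · rintro ⟨y, hy, rfl⟩
    simpa [mul_assoc] using hy
  · intro h
    exact ⟨_, h, by simp [mul_assoc]⟩

theorem card_conjSubgroup {G : Type*} [Group G] (P : Subgroup G) (g : G) :
    Nat.card ↥(conjSubgroup P g) = Nat.card ↥P :=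
  Subgroup.card_map_of_injective (MulAut.conj g⁻¹).injective

theorem conjSubgroup_mono {G : Type*} [Group G] {P Q : Subgroup G} (h : P ≤ Q) (g : G) :
    conjSubgroup P g ≤ conjSubgroup Q g :=
  Subgroup.map_mono h

theorem conjSubgroup_conjSubgroup_inv {G : Type*} [Group G] (P : Subgroup G) (g : G) :
    conjSubgroup (conjSubgroup P g) g⁻¹ = P := by
  ext x
  simp [mem_conjSubgroup, mul_assoc]

theorem conjSubgroup_centralizer_le {G : Type*} [Group G] (P : Subgroup G) (g : G) :
    conjSubgroup (Subgroup.centralizer (P : Set G)) g ≤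
      Subgroup.centralizer (conjSubgroup P g : Set G) := by
  rintro _ ⟨x, hx, rfl⟩ _ ⟨y, hy, rfl⟩
  rw [← map_mul, ← map_mul, hx y hy]

theorem IsPGroup.card_le_card_sylow {p : ℕ} [Fact p.Prime] {G : Type*} [Group G] [Finite G]
    {R : Subgroup G} (hR : IsPGroup p R) (Q : Sylow p G) :
    Nat.card R ≤ Nat.card (Q : Subgroup G) := by
  obtain ⟨T, hT⟩ := hR.exists_le_sylow
  exact (Subgroup.card_le_of_le hT).trans (Nat.card_congr (T.equiv Q).toEquiv).le

/-- Lemma 2.1 (group case): `P ≤ S` is fully centralized in `F_S(G)` iff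
`C_S(P)` is a Sylow `p`-subgroup of `C_G(P)`. -/
theorem fullyCentralized_iff_sylow_centralizer {p : ℕ} [Fact p.Prime]
    {G : Type*} [Group G] [Finite G]
    (S : Sylow p G) (P : Subgroup G) (hP : P ≤ (S : Subgroup G)) :
    (∀ g : G, conjSubgroup P g ≤ (S : Subgroup G) →
        Nat.card ↥((S : Subgroup G) ⊓ Subgroup.centralizer (P : Set G)) ≥
          Nat.card ↥((S : Subgroup G) ⊓
            Subgroup.centralizer ((conjSubgroup P g : Subgroup G) : Set G))) ↔
      ∃ Q : Sylow p ↥(Subgroup.centralizer (P : Set G)),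
        (Q : Subgroup ↥(Subgroup.centralizer (P : Set G))) =
          ((S : Subgroup G) ⊓ Subgroup.centralizer (P : Set G)).subgroupOf
            (Subgroup.centralizer (P : Set G)) := by
  have hD : IsPGroup p ↥((S : Subgroup G) ⊓ Subgroup.centralizer (P : Set G)) :=
    S.isPGroup'.to_le inf_le_left
  have hcard (R : Subgroup G) (hR : R ≤ Subgroup.centralizer (P : Set G)) :
      Nat.card ↥(R.subgroupOf (Subgroup.centralizer (P : Set G))) = Nat.card R :=
    Nat.card_congr (Subgroup.subgroupOfEquivOfLe hR).toEquiv
  constructor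
  · intro h
    obtain ⟨Q, hQ⟩ := (hD.of_equiv (Subgroup.subgroupOfEquivOfLe inf_le_right).symm).exists_le_sylow
    set R : Subgroup G := (Q : Subgroup ↥(Subgroup.centralizer (P : Set G))).map
      (Subgroup.centralizer (P : Set G)).subtype
    have hRC : R ≤ Subgroup.centralizer (P : Set G) := Subgroup.map_subtype_le _
    have hRp : IsPGroup p R := Q.isPGroup'.map _
    have hRP : IsPGroup p ↥(R ⊔ P) :=
      hRp.to_sup_of_normal_right' (S.isPGroup'.to_le hP)
        (hRC.trans (Subgroup.centralizer_le_normalizer _))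
    obtain ⟨T, hT⟩ := hRP.exists_le_sylow
    obtain ⟨g, rfl⟩ := MulAction.exists_smul_eq G S T
    have hS {K : Subgroup G} (hK : K ≤ R ⊔ P) : conjSubgroup K g ≤ (S : Subgroup G) := by
      rintro _ ⟨x, hx, rfl⟩
      have := hT (hK hx)
      rw [Sylow.coe_subgroup_smul, Subgroup.mem_pointwise_smul_iff_inv_smul_mem] at this
      simpa using this
    have hle : (S : Subgroup G) ⊓ Subgroup.centralizer (P : Set G) ≤ R := fun x hx ↦
      ⟨⟨x, hx.2⟩, hQ hx, rfl⟩
    have hconj : conjSubgroup R g ≤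
        (S : Subgroup G) ⊓ Subgroup.centralizer (conjSubgroup P g : Set G) :=
      le_inf (hS le_sup_left) ((conjSubgroup_mono hRC g).trans (conjSubgroup_centralizer_le P g))
    have hge : Nat.card R ≤ Nat.card ↥((S : Subgroup G) ⊓ Subgroup.centralizer (P : Set G)) := by
      rw [← card_conjSubgroup R g]
      exact (Subgroup.card_le_of_le hconj).trans (h g (hS le_sup_right))
    rw [Subgroup.eq_of_le_of_card_ge hle hge]
    exact ⟨Q, (Subgroup.comap_map_eq_self_of_injective (Subgroup.subtype_injective _) _).symm⟩
  · rintro ⟨Q, hQ⟩ g -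
    set E := (S : Subgroup G) ⊓ Subgroup.centralizer (conjSubgroup P g : Set G)
    have hE : conjSubgroup E g⁻¹ ≤ Subgroup.centralizer (P : Set G) := by
      have := (conjSubgroup_mono (inf_le_right : E ≤ _) g⁻¹).trans
        (conjSubgroup_centralizer_le (conjSubgroup P g) g⁻¹)
      rwa [conjSubgroup_conjSubgroup_inv] at this
    have hEp : IsPGroup p ↥(conjSubgroup E g⁻¹) :=
      (S.isPGroup'.to_le inf_le_left : IsPGroup p E).map _
    have hEC : IsPGroup p
        ↥((conjSubgroup E g⁻¹).subgroupOf (Subgroup.centralizer (P : Set G))) :=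
      hEp.of_equiv (Subgroup.subgroupOfEquivOfLe hE).symm
    have hEQ := hEC.card_le_card_sylow Q
    rwa [hQ, hcard _ hE, hcard _ inf_le_right, card_conjSubgroup] at hEQ
end

section
/- Let p be a prime, G a finite group, and S a Sylow p-subgroup of G. Let P ≤ S, and let h ∈ G be such that Q := P^h ≤ S and Q is fully centralized in F_S(G). Then P is centric in F_S(G) if and only if C_S(Q) ≤ Q. -/
theorem conjSubgroup_conjSubgroup {G : Type*} [Group G] (P : Subgroup G) (g k : G) :
    conjSubgroup (conjSubgroup P g) k = conjSubgroup P (g * k) := by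
  simp only [conjSubgroup, Subgroup.map_map]
  congr 1
  ext x
  simp [mul_assoc]

theorem card_inf_centralizer_le_card_conjSubgroup {G : Type*} [Group G] [Finite G]
    (P : Subgroup G) (g : G) :
    Nat.card ↥(P ⊓ Subgroup.centralizer (P : Set G)) ≤
      Nat.card ↥(conjSubgroup P g ⊓ Subgroup.centralizer (conjSubgroup P g : Set G)) := by
  have hinj : Function.Injective (MulAut.conj g⁻¹).toMonoidHom := (MulAut.conj g⁻¹).injective
  rw [← Subgroup.card_map_of_injective hinj]
  refine Subgroup.card_le_of_le ((Subgroup.map_inf_le _ _ _).trans (inf_le_inf_left _ ?_))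
  rw [conjSubgroup, Subgroup.coe_map]
  exact Subgroup.map_centralizer_le_centralizer_image _ _

/-- Lemma 1.10 for `F_S(G)`: if `Q = P^h` is a fully centralized `F_S(G)`-conjugate of
`P ≤ S`, then `P` is centric in `F_S(G)` iff `C_S(Q) ≤ Q`. -/
theorem centric_iff_centralizer_le {p : ℕ} [Fact p.Prime] {G : Type*} [Group G] [Finite G]
    (S : Sylow p G) (P : Subgroup G) (hP : P ≤ (S : Subgroup G))
    (h : G) (hQS : conjSubgroup P h ≤ (S : Subgroup G))
    (hfc : ∀ g : G, conjSubgroup (conjSubgroup P h) g ≤ (S : Subgroup G) →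
      Nat.card ↥((S : Subgroup G) ⊓
          Subgroup.centralizer ((conjSubgroup P h : Subgroup G) : Set G)) ≥
        Nat.card ↥((S : Subgroup G) ⊓
          Subgroup.centralizer ((conjSubgroup (conjSubgroup P h) g : Subgroup G) : Set G))) :
    (∀ g : G, conjSubgroup P g ≤ (S : Subgroup G) →
        (S : Subgroup G) ⊓ Subgroup.centralizer ((conjSubgroup P g : Subgroup G) : Set G) ≤
          conjSubgroup P g) ↔
      (S : Subgroup G) ⊓ Subgroup.centralizer ((conjSubgroup P h : Subgroup G) : Set G) ≤
        conjSubgroup P h := by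
  refine ⟨fun H => H h hQS, fun hQ g hg => ?_⟩
  have hconj : conjSubgroup (conjSubgroup P h) (h⁻¹ * g) = conjSubgroup P g := by
    rw [conjSubgroup_conjSubgroup, mul_inv_cancel_left]
  have hmax := hfc (h⁻¹ * g) (hconj ▸ hg)
  have hcenter := card_inf_centralizer_le_card_conjSubgroup (conjSubgroup P h) (h⁻¹ * g)
  rw [hconj] at hmax hcenter
  have heq := Subgroup.eq_of_le_of_card_ge (inf_le_inf_right _ hg)
    (hmax.le.trans ((Subgroup.card_le_of_le (le_inf hQ inf_le_right)).trans hcenter))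
  exact heq ▸ inf_le_left
end

section
/- Let p be a prime, G a finite group, S a Sylow p-subgroup of G, and N a normal subgroup of G; set T = S ∩ N. Let X and Y be subgroups of S with T ≤ X and T ≤ Y, and let g ∈ G be such that X^g ≤ YN. Then there exists g' ∈ G with g'N = gN, X^{g'} ≤ Y, and x^{g'}N = x^{g}N for every x ∈ X. (That is, every morphism X·N/N → Y·N/N in the fusion system F_{SN/N}(G/N) lifts to a morphism X → Y in F_S(G).) -/
/-- The second isomorphism theorem for indices, with the index of the non-normal factor. -/
theorem Subgroup.relIndex_sup_normal_right {G : Type*} [Group G] [Finite G]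
    (H N : Subgroup G) [N.Normal] : H.relIndex (H ⊔ N) = H.relIndex N := by
  have h₁ := Subgroup.relIndex_mul_relIndex (H ⊓ N) H (H ⊔ N) inf_le_left le_sup_left
  have h₂ := Subgroup.relIndex_mul_relIndex (H ⊓ N) N (H ⊔ N) inf_le_right le_sup_right
  rw [Subgroup.inf_relIndex_left] at h₁
  rw [Subgroup.inf_relIndex_right, Subgroup.relIndex_sup_right] at h₂
  have h₀ : N.relIndex H ≠ 0 := Subgroup.index_ne_zero_of_finite
  apply Nat.eq_of_mul_eq_mul_left (Nat.pos_of_ne_zero h₀)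
  rw [h₁, ← h₂, mul_comm]

/-- A subgroup `Y` of a Sylow subgroup `S` that contains `S ∩ N` has index prime to `p`
in `YN`. -/
theorem Sylow.not_dvd_relIndex_sup_normal {p : ℕ} [Fact p.Prime] {G : Type*} [Group G] [Finite G]
    (S : Sylow p G) (N : Subgroup G) [N.Normal] {Y : Subgroup G}
    (hY : Y ≤ (S : Subgroup G)) (hTY : (S : Subgroup G) ⊓ N ≤ Y) :
    ¬ p ∣ Y.relIndex (Y ⊔ N) := by
  have hinf : Y ⊓ N = (S : Subgroup G) ⊓ N :=
    le_antisymm (inf_le_inf_right N hY) (le_inf hTY inf_le_right)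
  rw [Subgroup.relIndex_sup_normal_right, ← Subgroup.inf_relIndex_right, hinf,
    Subgroup.inf_relIndex_right, ← Subgroup.relIndex_sup_normal_right]
  exact fun h ↦ S.not_dvd_index (h.trans (Subgroup.relIndex_dvd_index_of_le le_sup_left))

/-- Sylow's second theorem inside a subgroup `K`: a `p`-subgroup `P` of `K` is conjugate in `K`
into any `p`-subgroup `Q` of `K` of index prime to `p`. -/
theorem IsPGroup.exists_conj_mem_of_not_dvd_relIndex {p : ℕ} [Fact p.Prime] {G : Type*} [Group G]
    [Finite G] {P Q K : Subgroup G} (hP : IsPGroup p P) (hQ : IsPGroup p Q) (hPK : P ≤ K)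
    (hQK : ¬ p ∣ Q.relIndex K) : ∃ k ∈ K, ∀ x ∈ P, k⁻¹ * x * k ∈ Q := by
  obtain ⟨R, hR⟩ := (hP.comap_subtype (K := K)).exists_le_sylow
  obtain ⟨k, hk⟩ := MulAction.exists_smul_eq K ((hQ.comap_subtype (K := K)).toSylow hQK) R
  refine ⟨k, k.2, fun x hx ↦ ?_⟩
  have hxR : (⟨x, hPK hx⟩ : K) ∈ (R : Subgroup K) := hR hx
  rw [← hk, Sylow.coe_subgroup_smul, Subgroup.mem_pointwise_smul_iff_inv_smul_mem, ← map_inv,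
    MulAut.smul_def, MulAut.conj_apply, inv_inv] at hxR
  exact hxR

/-- Lemma 5.4(a) (group case): for `N ⊴ G`, `T = S ∩ N`, and `T ≤ X, Y ≤ S`, every
morphism `X·N/N → Y·N/N` in `F_{SN/N}(G/N)` lifts to a morphism `X → Y` in `F_S(G)`:
if `X^g ≤ YN` then there is `g'` with `g'N = gN`, `X^{g'} ≤ Y`, and
`x^{g'}N = x^gN` for all `x ∈ X`. -/
theorem lift_quotient_fusion {p : ℕ} [Fact p.Prime] {G : Type*} [Group G] [Finite G]
    (S : Sylow p G) (N : Subgroup G) (hN : N.Normal)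
    (X Y : Subgroup G) (hX : X ≤ (S : Subgroup G)) (hY : Y ≤ (S : Subgroup G))
    (hTX : (S : Subgroup G) ⊓ N ≤ X) (hTY : (S : Subgroup G) ⊓ N ≤ Y)
    (g : G) (hg : conjSubgroup X g ≤ Y ⊔ N) :
    ∃ g' : G, g⁻¹ * g' ∈ N ∧ conjSubgroup X g' ≤ Y ∧
      ∀ x ∈ X, (g'⁻¹ * x * g')⁻¹ * (g⁻¹ * x * g) ∈ N := by
  have hXp : IsPGroup p (conjSubgroup X g) := (S.isPGroup'.to_le hX).map _
  obtain ⟨k, hk, hkY⟩ := hXp.exists_conj_mem_of_not_dvd_relIndex (S.isPGroup'.to_le hY) hg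
    (S.not_dvd_relIndex_sup_normal N hY hTY)
  rw [sup_comm] at hk
  obtain ⟨n, hn, y, hy, rfl⟩ := Subgroup.mem_sup_of_normal_left.mp hk
  refine ⟨g * n, by simpa using hn, ?_, fun x _ ↦ ?_⟩
  · rintro _ ⟨x, hx, rfl⟩
    have h := Y.mul_mem (Y.mul_mem hy (hkY _ ⟨x, hx, rfl⟩)) (Y.inv_mem hy)
    simpa [mul_assoc] using h
  · have h := N.mul_mem (N.inv_mem hn)
      (hN.conj_mem n hn (g⁻¹ * x⁻¹ * g))
    simpa [mul_assoc] using h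
end
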